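/- arXiv:0903.4754 — 2 statements merged into one kernel-verified Lean document; each statement's English description precedes it below -/
import Mathlib

section
/- Let n ≥ 2 and let f : EuclideanSpace ℝ (Fin (n+1)) → ℝ be continuous. Suppose that for every 2-dimensional linear subspace P of EuclideanSpace ℝ (Fin (n+1)) the integral of f over the great circle P ∩ Metric.sphere 0 1 with respect to the 1-dimensional Hausdorff measure vanishes. Then f(-x) = -f(x) for every x with ‖x‖ = 1. -/
open MeasureTheory

open Real in
/-- The discrepancy between the average of `g` over the sphere `S²` along one coordinate, in
spherical coordinates, and Archimedes' formula for it. -/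
noncomputable def archimedesDefect (g : ℝ → ℝ) : ℝ :=
  (∫ a in (0 : ℝ)..π, (∫ t in (0 : ℝ)..2 * π, g (sin a * cos t)) * sin a) -
    2 * π * ∫ u in (-1 : ℝ)..1, g u

open Real in
theorem continuous_integral_sin_mul_cos {g : ℝ → ℝ} (hg : Continuous g) :
    Continuous fun a : ℝ => ∫ t in (0 : ℝ)..2 * π, g (sin a * cos t) :=
  intervalIntegral.continuous_parametric_intervalIntegral_of_continuous' (by fun_prop) _ _

open Real in
theorem archimedesDefect_add {g h : ℝ → ℝ} (hg : Continuous g) (hh : Continuous h) :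
    archimedesDefect (fun x => g x + h x) = archimedesDefect g + archimedesDefect h := by
  have hg' := continuous_integral_sin_mul_cos hg
  have hh' := continuous_integral_sin_mul_cos hh
  have key : ∀ a : ℝ, ∫ t in (0 : ℝ)..2 * π, (g (sin a * cos t) + h (sin a * cos t)) =
      (∫ t in (0 : ℝ)..2 * π, g (sin a * cos t)) + ∫ t in (0 : ℝ)..2 * π, h (sin a * cos t) :=
    fun a => intervalIntegral.integral_add
      (Continuous.intervalIntegrable (by fun_prop) _ _)
      (Continuous.intervalIntegrable (by fun_prop) _ _)
  simp only [archimedesDefect, key, add_mul]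
  rw [intervalIntegral.integral_add (Continuous.intervalIntegrable (by fun_prop) _ _)
      (Continuous.intervalIntegrable (by fun_prop) _ _),
    intervalIntegral.integral_add (hg.intervalIntegrable _ _) (hh.intervalIntegrable _ _)]
  ring

theorem archimedesDefect_const_mul (c : ℝ) (g : ℝ → ℝ) :
    archimedesDefect (fun x => c * g x) = c * archimedesDefect g := by
  simp only [archimedesDefect, intervalIntegral.integral_const_mul, mul_assoc, mul_sub]
  ring

open Real in
theorem archimedesDefect_pow_eq (k : ℕ) :
    archimedesDefect (fun x => x ^ k) =
      (∫ a in (0 : ℝ)..π, sin a ^ (k + 1)) * (∫ t in (0 : ℝ)..2 * π, cos t ^ k) -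
        2 * π * ∫ u in (-1 : ℝ)..1, u ^ k := by
  simp only [archimedesDefect, mul_pow, intervalIntegral.integral_const_mul]
  rw [← intervalIntegral.integral_mul_const]
  congr 2
  ext a
  ring

open Real in
theorem archimedesDefect_pow (k : ℕ) : archimedesDefect (fun x => x ^ k) = 0 := by
  induction k using Nat.twoStepInduction with
  | zero => rw [archimedesDefect_pow_eq]; norm_num; ring
  | one => rw [archimedesDefect_pow_eq]; simp
  | more k ih _ =>
    rw [archimedesDefect_pow_eq] at ih ⊢
    have h1 := integral_sin_pow (a := 0) (b := π) (k + 1)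
    have h2 := integral_cos_pow (a := 0) (b := 2 * π) k
    have h3 : ∫ u in (-1 : ℝ)..1, u ^ (k + 2) = (k + 1) / (k + 3) * ∫ u in (-1 : ℝ)..1, u ^ k := by
      rw [integral_pow, integral_pow]
      push_cast
      field_simp
      ring
    rw [h3, h2, show k + 2 + 1 = k + 1 + 2 by ring, h1]
    simp only [sin_zero, sin_pi, sin_two_pi]
    push_cast
    have e : ((k : ℝ) + 1 + 1) / (k + 1 + 2) * ((k + 1) / (k + 2)) = (k + 1) / (k + 3) := by
      field_simp
      ring
    linear_combination ((k + 1 : ℝ) / (k + 3)) * ih +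
      (∫ a in (0 : ℝ)..π, sin a ^ (k + 1)) * (∫ t in (0 : ℝ)..2 * π, cos t ^ k) * e

theorem archimedesDefect_polynomial (p : Polynomial ℝ) :
    archimedesDefect (fun x => p.eval x) = 0 := by
  induction p using Polynomial.induction_on' with
  | add p q hp hq =>
    simp only [Polynomial.eval_add]
    rw [archimedesDefect_add p.continuous q.continuous, hp, hq, add_zero]
  | monomial k c =>
    simp only [Polynomial.eval_monomial]
    rw [archimedesDefect_const_mul, archimedesDefect_pow, mul_zero]

open Real in
theorem abs_archimedesDefect_le {g : ℝ → ℝ} {ε : ℝ}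
    (h : ∀ x ∈ Set.Icc (-1 : ℝ) 1, |g x| ≤ ε) :
    |archimedesDefect g| ≤ (2 * π * π + 4 * π) * ε := by
  have hpi := pi_pos
  have h1 : ∀ a : ℝ, ‖∫ t in (0 : ℝ)..2 * π, g (sin a * cos t)‖ ≤ ε * |2 * π - 0| := fun a =>
    intervalIntegral.norm_integral_le_of_norm_le_const fun t _ => h _ <| abs_le.1 <| by
      rw [abs_mul]
      exact mul_le_one₀ (abs_sin_le_one _) (abs_nonneg _) (abs_cos_le_one _)
  have h2 : ‖∫ a in (0 : ℝ)..π, (∫ t in (0 : ℝ)..2 * π, g (sin a * cos t)) * sin a‖ ≤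
      (ε * |2 * π - 0|) * |π - 0| :=
    intervalIntegral.norm_integral_le_of_norm_le_const fun a _ => by
      rw [norm_mul]
      exact (mul_le_of_le_one_right (norm_nonneg _) (abs_sin_le_one _)).trans (h1 a)
  have h3 : ‖∫ u in (-1 : ℝ)..1, g u‖ ≤ ε * |1 - (-1)| :=
    intervalIntegral.norm_integral_le_of_norm_le_const fun u hu => h u <| by
      rw [Set.uIoc_of_le (by norm_num)] at hu
      exact ⟨hu.1.le, hu.2⟩
  rw [sub_zero, sub_zero, abs_of_pos (by positivity), abs_of_pos hpi] at h2
  norm_num at h3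
  rw [norm_eq_abs] at h2
  unfold archimedesDefect
  refine (abs_sub _ _).trans ?_
  rw [abs_mul, abs_of_pos (show 0 < 2 * π by positivity)]
  nlinarith

theorem archimedesDefect_eq_zero {g : ℝ → ℝ} (hg : Continuous g) : archimedesDefect g = 0 := by
  set K := 2 * Real.pi * Real.pi + 4 * Real.pi
  have hK : 0 < K := by positivity
  refine abs_eq_zero.1 (le_antisymm (le_of_forall_pos_le_add fun ε hε => ?_) (abs_nonneg _))
  obtain ⟨p, hp⟩ := exists_polynomial_near_of_continuousOn (-1) 1 g hg.continuousOn (ε / K)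
    (by positivity)
  have h : archimedesDefect g = archimedesDefect (fun x => g x - p.eval x) := by
    have h' := archimedesDefect_add (g := fun x => g x - p.eval x) (hg.sub p.continuous)
      p.continuous
    simpa only [sub_add_cancel, archimedesDefect_polynomial, add_zero] using h'
  rw [h, zero_add]
  refine (abs_archimedesDefect_le (ε := ε / K) fun x hx => ?_).trans_eq
    (mul_div_cancel₀ _ hK.ne')
  rw [abs_sub_comm]
  exact (hp x hx).le

open Real in
/-- If all integrals `∫ g (s cos t) dt` over a full period vanish, then `g` is odd at `1`. -/
theorem add_eq_zero_of_integral_mul_cos_eq_zero {g : ℝ → ℝ} (hg : Continuous g)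
    (h : ∀ s ∈ Set.Icc (0 : ℝ) 1, ∫ t in (0 : ℝ)..2 * π, g (s * cos t) = 0) :
    g 1 + g (-1) = 0 := by
  have h1 : ∀ r ∈ Set.Icc (0 : ℝ) 1, ∫ u in (-1 : ℝ)..1, g (r * u) = 0 := by
    intro r hr
    have hd := archimedesDefect_eq_zero (g := fun x => g (r * x)) (by fun_prop)
    have h0 : ∫ a in (0 : ℝ)..π, (∫ t in (0 : ℝ)..2 * π, g (r * (sin a * cos t))) * sin a = 0 := by
      rw [intervalIntegral.integral_congr (g := fun _ => 0), intervalIntegral.integral_zero]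
      intro a ha
      rw [Set.uIcc_of_le pi_pos.le] at ha
      have hs := sin_nonneg_of_mem_Icc ha
      simp only [← mul_assoc]
      rw [h _ ⟨mul_nonneg hr.1 hs, mul_le_one₀ hr.2 hs (sin_le_one a)⟩, zero_mul]
    rw [archimedesDefect, h0, zero_sub, neg_eq_zero] at hd
    exact (mul_eq_zero.1 hd).resolve_left (by positivity)
  have h2 : ∀ r ∈ Set.Ioo (0 : ℝ) 1, ∫ u in (0 : ℝ)..r, (g u + g (-u)) = 0 := by
    intro r hr
    have h3 := h1 r ⟨hr.1.le, hr.2.le⟩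
    rw [intervalIntegral.integral_comp_mul_left g hr.1.ne', smul_eq_mul, mul_neg_one, mul_one] at h3
    have h4 := (mul_eq_zero.1 h3).resolve_left (inv_ne_zero hr.1.ne')
    rw [intervalIntegral.integral_add (hg.intervalIntegrable _ _)
      (Continuous.intervalIntegrable (by fun_prop) _ _), intervalIntegral.integral_comp_neg,
      neg_zero, add_comm, intervalIntegral.integral_add_adjacent_intervals
        (hg.intervalIntegrable _ _) (hg.intervalIntegrable _ _), h4]
  have hc : Continuous fun u => g u + g (-u) := by fun_prop
  have h5 : Set.EqOn (fun u => g u + g (-u)) (fun _ => 0) (Set.Ioo 0 1) := by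
    intro r hr
    have hd := hc.deriv_integral _ 0 r
    rw [Filter.EventuallyEq.deriv_eq (f := fun _ => 0)
      (Filter.eventually_of_mem (isOpen_Ioo.mem_nhds hr) h2), deriv_const] at hd
    exact hd.symm
  have h6 := h5.closure hc continuous_const
  rw [closure_Ioo zero_ne_one] at h6
  exact h6 (Set.right_mem_Icc.2 zero_le_one)

open Real in
theorem hausdorffMeasure_unitCircle_ne_top : μH[1] (Metric.sphere (0 : ℂ) 1) ≠ ⊤ := by
  have h := (lipschitzWith_circleMap 0 1).hausdorffMeasure_image_le zero_le_one
    (Set.Ioc 0 (2 * π))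
  rw [image_circleMap_Ioc, abs_one, hausdorffMeasure_real, Real.volume_Ioc] at h
  exact ne_top_of_le_ne_top (ENNReal.mul_ne_top (by simp) ENNReal.ofReal_ne_top) h

theorem hausdorffMeasure_unitCircle_ne_zero : μH[1] (Metric.sphere (0 : ℂ) 1) ≠ 0 := by
  intro h
  have hl : LipschitzWith 1 Complex.re := LipschitzWith.of_dist_le_mul fun x y => by
    simpa [dist_eq_norm] using Complex.abs_re_le_norm (x - y)
  have h1 := hl.hausdorffMeasure_image_le zero_le_one (Metric.sphere (0 : ℂ) 1)
  rw [h, mul_zero, hausdorffMeasure_real] at h1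
  have h2 : Set.Icc (-1 : ℝ) 1 ⊆ Complex.re '' Metric.sphere (0 : ℂ) 1 := by
    intro x hx
    refine ⟨Complex.exp (Real.arccos x * Complex.I), by simp, ?_⟩
    rw [Complex.exp_ofReal_mul_I_re, Real.cos_arccos hx.1 hx.2]
  have h3 := (measure_mono h2).trans h1
  rw [Real.volume_Icc] at h3
  norm_num at h3

open Real in
/-- A continuous function with zero mean over the unit circle for the Hausdorff measure has zero
mean for the angular measure. -/
theorem integral_exp_eq_zero_of_setIntegral_unitCircle {F : ℂ → ℝ} (hF : Continuous F)
    (h : ∫ z in Metric.sphere (0 : ℂ) 1, F z ∂μH[1] = 0) :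
    ∫ a in (0 : ℝ)..2 * π, F (Complex.exp (a * Complex.I)) = 0 := by
  set ν : Measure ℂ := (μH[1]).restrict (Metric.sphere (0 : ℂ) 1) with hν
  have hfin : IsFiniteMeasure ν := ⟨by
    rw [hν, Measure.restrict_apply_univ]
    exact hausdorffMeasure_unitCircle_ne_top.lt_top⟩
  have hinv : ∀ a : ℝ, ∫ z, F (z * Complex.exp (a * Complex.I)) ∂ν = 0 := by
    intro a
    let e := (rotation (Circle.exp a)).toIsometryEquiv
    have he := (e.measurePreserving_hausdorffMeasure 1).setIntegral_preimage_emb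
      e.toHomeomorph.measurableEmbedding F (Metric.sphere (0 : ℂ) 1)
    have hs : e ⁻¹' Metric.sphere (0 : ℂ) 1 = Metric.sphere (0 : ℂ) 1 := by
      ext z
      rw [Set.mem_preimage, mem_sphere_zero_iff_norm, mem_sphere_zero_iff_norm]
      exact Eq.congr_left ((rotation (Circle.exp a)).norm_map z)
    rw [hs, h] at he
    rw [← he]
    refine integral_congr_ae (Filter.Eventually.of_forall fun z => ?_)
    simp [e, mul_comm]
  have hper : ∀ z ∈ Metric.sphere (0 : ℂ) 1,
      ∫ a in (0 : ℝ)..2 * π, F (z * Complex.exp (a * Complex.I)) =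
        ∫ a in (0 : ℝ)..2 * π, F (Complex.exp (a * Complex.I)) := by
    intro z hz
    have hz' : z = Complex.exp (z.arg * Complex.I) := by
      have := Complex.norm_mul_exp_arg_mul_I z
      rw [mem_sphere_zero_iff_norm.1 hz] at this
      simpa using this.symm
    have hp : Function.Periodic (fun a : ℝ => F (Complex.exp (a * Complex.I))) (2 * π) := by
      intro a
      simp [add_mul, Complex.exp_add]
    have h1 := intervalIntegral.integral_comp_add_left (a := 0) (b := 2 * π)
      (fun a : ℝ => F (Complex.exp (a * Complex.I))) z.arg
    have h2 := hp.intervalIntegral_add_eq z.arg 0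
    rw [zero_add] at h2
    rw [add_zero, h2] at h1
    rw [← h1]
    refine intervalIntegral.integral_congr fun a _ => ?_
    conv_lhs => rw [hz']
    simp [add_mul, Complex.exp_add]
  have hF_int : Integrable
      (Function.uncurry fun (a : ℝ) (z : ℂ) => F (z * Complex.exp (a * Complex.I)))
      ((volume.restrict (Set.uIoc 0 (2 * π))).prod ν) := by
    obtain ⟨C, hC⟩ := (isCompact_closedBall (0 : ℂ) 1).exists_bound_of_continuousOn
      hF.continuousOn
    rw [Set.uIoc_of_le two_pi_pos.le]
    refine Integrable.of_bound (Continuous.aestronglyMeasurable (by fun_prop)) C ?_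
    have hsph : ∀ᵐ z ∂ν, z ∈ Metric.sphere (0 : ℂ) 1 :=
      ae_restrict_mem Metric.isClosed_sphere.measurableSet
    filter_upwards [Measure.quasiMeasurePreserving_snd.ae hsph] with q hq
    refine hC _ ?_
    rw [mem_closedBall_zero_iff, norm_mul, Complex.norm_exp_ofReal_mul_I, mul_one]
    exact (mem_sphere_zero_iff_norm.1 hq).le
  have hsw := intervalIntegral_integral_swap hF_int
  simp only [hinv, intervalIntegral.integral_zero] at hsw
  rw [hν, setIntegral_congr_fun Metric.isClosed_sphere.measurableSet hper, setIntegral_const] at hsw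
  refine (smul_eq_zero.1 hsw.symm).resolve_left ?_
  rw [Measure.real, ← ne_eq, ENNReal.toReal_ne_zero]
  exact ⟨hausdorffMeasure_unitCircle_ne_zero, hausdorffMeasure_unitCircle_ne_top⟩

open Real in
/-- A continuous function whose integral over the unit circle of every plane vanishes has vanishing
angular integrals along orthonormal frames. -/
theorem integral_cos_smul_add_sin_smul_eq_zero {E : Type*} [NormedAddCommGroup E]
    [InnerProductSpace ℝ E] [MeasurableSpace E] [BorelSpace E] {f : E → ℝ} (hf : Continuous f)
    (hfunk : ∀ P : Submodule ℝ E, Module.finrank ℝ P = 2 →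
      ∫ x in (P : Set E) ∩ Metric.sphere 0 1, f x ∂μH[1] = 0)
    {u v : E} (hu : ‖u‖ = 1) (hv : ‖v‖ = 1) (huv : inner ℝ u v = 0) :
    ∫ t in (0 : ℝ)..2 * π, f (cos t • u + sin t • v) = 0 := by
  let ι : ℂ →ₗᵢ[ℝ] E :=
    { toLinearMap := Complex.reLm.smulRight u + Complex.imLm.smulRight v
      norm_map' := fun z => by
        rw [← sq_eq_sq₀ (norm_nonneg _) (norm_nonneg _)]
        simp only [LinearMap.add_apply, LinearMap.smulRight_apply, Complex.reLm_coe,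
          Complex.imLm_coe]
        rw [norm_add_sq_real, inner_smul_left, inner_smul_right, huv, norm_smul, norm_smul, hu, hv,
          Complex.sq_norm, Complex.normSq_apply]
        simp only [norm_eq_abs, mul_one, mul_zero, add_zero, sq_abs]
        ring }
  have hι : ∀ z : ℂ, ι z = z.re • u + z.im • v := fun z => rfl
  have hP := hfunk ι.toLinearMap.range <| by
    rw [LinearMap.finrank_range_of_inj ι.injective, Complex.finrank_real_complex]
  have hemb : MeasurableEmbedding ι := ι.isometry.isClosedEmbedding.measurableEmbedding
  have hmap := ι.isometry.map_hausdorffMeasure (d := 1) (Or.inl zero_le_one)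
  have hset : ι ⁻¹' Metric.sphere 0 1 = Metric.sphere 0 1 := by
    ext z
    simp
  have h := hemb.setIntegral_map (μ := μH[1]) f (Metric.sphere 0 1)
  rw [hmap, Measure.restrict_restrict Metric.isClosed_sphere.measurableSet, Set.inter_comm,
    hset] at h
  have h' := integral_exp_eq_zero_of_setIntegral_unitCircle (F := fun z => f (ι z))
    (hf.comp ι.continuous) (h.symm.trans hP)
  simpa only [hι, Complex.exp_ofReal_mul_I_re, Complex.exp_ofReal_mul_I_im] using h'

theorem intervalIntegral_swap_of_continuous {F : ℝ → ℝ → ℝ} (hF : Continuous (Function.uncurry F))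
    {a b c d : ℝ} (hab : a ≤ b) (hcd : c ≤ d) :
    ∫ x in a..b, ∫ y in c..d, F x y = ∫ y in c..d, ∫ x in a..b, F x y := by
  simp only [intervalIntegral.integral_of_le hab, intervalIntegral.integral_of_le hcd]
  refine integral_integral_swap ?_
  rw [Measure.prod_restrict, ← Measure.volume_eq_prod]
  exact (hF.continuousOn.integrableOn_compact (isCompact_Icc.prod isCompact_Icc)).mono_set
    (Set.prod_mono Set.Ioc_subset_Icc_self Set.Ioc_subset_Icc_self)

open Real in
/-- A continuous function with vanishing angular integrals along orthonormal frames is odd on the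
unit sphere, at any unit vector which is part of an orthonormal triple. -/
theorem add_eq_zero_of_integral_cos_smul_add_sin_smul_eq_zero {E : Type*} [NormedAddCommGroup E]
    [InnerProductSpace ℝ E] {f : E → ℝ} (hf : Continuous f)
    (h : ∀ u v : E, ‖u‖ = 1 → ‖v‖ = 1 → inner ℝ u v = 0 →
      ∫ t in (0 : ℝ)..2 * π, f (cos t • u + sin t • v) = 0)
    {b : Fin 3 → E} (hb : Orthonormal ℝ b) : f (b 0) + f (-b 0) = 0 := by
  let R : ℝ → E := fun φ => cos φ • b 1 + sin φ • b 2
  have hR : Continuous R := by fun_prop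
  let g : ℝ → ℝ := fun z => ∫ φ in (0 : ℝ)..2 * π, f (z • b 0 + √(1 - z ^ 2) • R φ)
  have hg : Continuous g :=
    intervalIntegral.continuous_parametric_intervalIntegral_of_continuous' (by fun_prop) _ _
  have hkey := add_eq_zero_of_integral_mul_cos_eq_zero hg fun s hs => ?_
  · have h1 : g 1 = 2 * π * f (b 0) := by simp [g]
    have h2 : g (-1) = 2 * π * f (-b 0) := by simp [g]
    rw [h1, h2, ← mul_add] at hkey
    exact (mul_eq_zero.1 hkey).resolve_left (by positivity)
  set c := √(1 - s ^ 2)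
  have hc2 : c ^ 2 = 1 - s ^ 2 := sq_sqrt (by nlinarith [hs.1, hs.2])
  let R' : ℝ → E := fun φ => -sin φ • b 1 + cos φ • b 2
  have hR' : Continuous R' := by fun_prop
  have hn : ∀ i, inner ℝ (b i) (b i) = 1 := fun i => by simp [hb.1 i]
  have h01 : inner ℝ (b 0) (b 1) = 0 := hb.2 (by decide)
  have h02 : inner ℝ (b 0) (b 2) = 0 := hb.2 (by decide)
  have h12 : inner ℝ (b 1) (b 2) = 0 := hb.2 (by decide)
  have h10 : inner ℝ (b 1) (b 0) = 0 := hb.2 (by decide)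
  have h20 : inner ℝ (b 2) (b 0) = 0 := hb.2 (by decide)
  have h21 : inner ℝ (b 2) (b 1) = 0 := hb.2 (by decide)
  have hcircle : ∀ φ, ∫ t in (0 : ℝ)..2 * π, f (cos t • (s • b 0 + c • R φ) + sin t • R' φ) = 0 := by
    intro φ
    have hsc := sin_sq_add_cos_sq φ
    refine h _ _ ?_ ?_ ?_
    · rw [← sq_eq_sq₀ (norm_nonneg _) zero_le_one, ← real_inner_self_eq_norm_sq]
      simp only [R, inner_add_left, inner_add_right, inner_smul_left, inner_smul_right, hn, h01,
        h02, h12, h10, h20, h21, conj_trivial]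
      linear_combination hc2 + c ^ 2 * hsc
    · rw [← sq_eq_sq₀ (norm_nonneg _) zero_le_one, ← real_inner_self_eq_norm_sq]
      simp only [R', inner_add_left, inner_add_right, inner_smul_left, inner_smul_right, hn,
        h12, h21, conj_trivial]
      linear_combination hsc
    · simp only [R, R', inner_add_left, inner_add_right, inner_smul_left, inner_smul_right, hn,
        h01, h02, h12, h21, conj_trivial]
      ring
  have hrot : ∀ t, g (s * cos t) =
      ∫ φ in (0 : ℝ)..2 * π, f (cos t • (s • b 0 + c • R φ) + sin t • R' φ) := by
    intro t
    let w : ℂ := ⟨c * cos t, sin t⟩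
    have hw : ‖w‖ = √(1 - (s * cos t) ^ 2) := by
      rw [Complex.norm_def, Complex.normSq_apply]
      congr 1
      linear_combination cos t ^ 2 * hc2 + sin_sq_add_cos_sq t
    have hre : ‖w‖ * cos w.arg = c * cos t := Complex.norm_mul_cos_arg w
    have him : ‖w‖ * sin w.arg = sin t := Complex.norm_mul_sin_arg w
    have hp : Function.Periodic (fun φ => f ((s * cos t) • b 0 + ‖w‖ • R φ)) (2 * π) := by
      intro φ
      simp [R]
    have h1 := intervalIntegral.integral_comp_add_left (a := 0) (b := 2 * π)
      (fun φ => f ((s * cos t) • b 0 + ‖w‖ • R φ)) w.arg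
    have h2 := hp.intervalIntegral_add_eq w.arg 0
    rw [zero_add] at h2
    rw [add_zero, h2] at h1
    simp only [g, ← hw]
    rw [← h1]
    refine intervalIntegral.integral_congr fun φ _ => congrArg f ?_
    simp only [R, R', cos_add, sin_add]
    linear_combination (norm := module) hre • (cos φ • b 1 + sin φ • b 2) +
      him • (-sin φ • b 1 + cos φ • b 2)
  simp only [hrot]
  rw [intervalIntegral_swap_of_continuous (by fun_prop) two_pi_pos.le two_pi_pos.le]
  simp only [hcircle, intervalIntegral.integral_zero]

theorem exists_orthonormal_fin_three {n : ℕ} (hn : 2 ≤ n) {x : EuclideanSpace ℝ (Fin (n + 1))}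
    (hx : ‖x‖ = 1) :
    ∃ b : Fin 3 → EuclideanSpace ℝ (Fin (n + 1)), Orthonormal ℝ b ∧ b 0 = x := by
  obtain ⟨b, hb⟩ := Orthonormal.exists_orthonormalBasis_extension_of_card_eq (𝕜 := ℝ)
    (ι := Fin (n + 1)) (by simp) (v := fun _ => x) (s := {0})
    ⟨fun _ => hx, fun i j hij => (hij (Subsingleton.elim i j)).elim⟩
  refine ⟨b ∘ Fin.castLE (by omega), b.orthonormal.comp _ (Fin.castLE_injective _), ?_⟩
  exact hb 0 rfl

/-- Funk's theorem, formulated with the 1-dimensional Hausdorff measure: a continuous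
function on `S^n` (`n ≥ 2`) whose integral over every great circle (the intersection of
the unit sphere with a 2-dimensional linear subspace) vanishes is odd on the sphere. -/
theorem funk_theorem_hausdorff (n : ℕ) (hn : 2 ≤ n)
    (f : EuclideanSpace ℝ (Fin (n + 1)) → ℝ) (hf : Continuous f)
    (hfunk : ∀ P : Submodule ℝ (EuclideanSpace ℝ (Fin (n + 1))),
      Module.finrank ℝ P = 2 →
      (∫ x in (P : Set (EuclideanSpace ℝ (Fin (n + 1)))) ∩ Metric.sphere 0 1,
        f x ∂(μH[1])) = 0) :
    ∀ x : EuclideanSpace ℝ (Fin (n + 1)), ‖x‖ = 1 → f (-x) = -f x := by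
  intro x hx
  obtain ⟨b, hb, rfl⟩ := exists_orthonormal_fin_three hn hx
  have h := add_eq_zero_of_integral_cos_smul_add_sin_smul_eq_zero hf
    (fun u v hu hv huv => integral_cos_smul_add_sin_smul_eq_zero hf hfunk hu hv huv) hb
  linarith
end

section
/- Let n ≥ 2 and let f : EuclideanSpace ℝ (Fin (n+1)) → ℝ be continuous and even on the unit sphere, i.e. f(-x) = f(x) for every x with ‖x‖ = 1. Suppose that for every pair of orthonormal vectors u, v one has ∫_{0}^{2π} f((cos t) • u + (sin t) • v) dt = 0. Then f(x) = 0 for every x with ‖x‖ = 1. In other words, the Funk transform is injective on even continuous functions on S^n. -/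
open Real
open scoped RealInnerProductSpace

/-- The product of two consecutive Wallis integrals. -/
theorem integral_sin_pow_succ_mul_integral_sin_pow (k : ℕ) :
    (∫ s in (0 : ℝ)..π, sin s ^ (k + 1)) * (∫ t in (0 : ℝ)..π, sin t ^ k) =
      2 * π / (k + 1) := by
  induction k with
  | zero => simp; norm_num
  | succ k ih =>
    rw [integral_sin_pow k]
    have h1 : (k : ℝ) + 1 ≠ 0 := by positivity
    have h2 : (k : ℝ) + 2 ≠ 0 := by positivity
    simp only [sin_zero, sin_pi, ne_eq, Nat.add_eq_zero_iff, one_ne_zero, and_false,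
      not_false_eq_true, zero_pow, zero_mul, sub_zero, zero_div, zero_add]
    rw [mul_assoc, mul_comm (∫ t in (0 : ℝ)..π, sin t ^ k), ih]
    push_cast
    field_simp
    ring

theorem Polynomial.integral_sin_mul_integral_eval_sin_mul_sin (p : Polynomial ℝ) (r : ℝ) :
    (∫ s in (0 : ℝ)..π, sin s * ∫ t in (0 : ℝ)..π, p.eval (r * sin s * sin t)) =
      2 * π * ∫ z in (0 : ℝ)..1, p.eval (r * z) := by
  induction p using Polynomial.induction_on' with
  | add p q hp hq =>
    have hc (p : Polynomial ℝ) :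
        Continuous fun s => ∫ t in (0 : ℝ)..π, p.eval (r * sin s * sin t) := by
      refine intervalIntegral.continuous_parametric_intervalIntegral_of_continuous' ?_ _ _
      exact p.continuous.comp (by fun_prop)
    have hi (p : Polynomial ℝ) (c a b : ℝ) :
        IntervalIntegrable (fun t => p.eval (c * sin t)) MeasureTheory.volume a b :=
      (p.continuous.comp (by fun_prop)).intervalIntegrable _ _
    have hj (p : Polynomial ℝ) (a b : ℝ) :
        IntervalIntegrable (fun z => p.eval (r * z)) MeasureTheory.volume a b :=
      (p.continuous.comp (by fun_prop)).intervalIntegrable _ _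
    have hk (p : Polynomial ℝ) (a b : ℝ) :
        IntervalIntegrable (fun s => sin s * ∫ t in (0 : ℝ)..π, p.eval (r * sin s * sin t))
          MeasureTheory.volume a b :=
      (continuous_sin.mul (hc p)).intervalIntegrable _ _
    simp only [Polynomial.eval_add]
    rw [intervalIntegral.integral_add (hj p _ _) (hj q _ _), mul_add, ← hp, ← hq,
      ← intervalIntegral.integral_add (hk p _ _) (hk q _ _)]
    congr 1
    ext s
    rw [intervalIntegral.integral_add (hi p _ _ _) (hi q _ _ _), mul_add]
  | monomial k c =>
    have h := integral_sin_pow_succ_mul_integral_sin_pow k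
    simp only [Polynomial.eval_monomial, mul_pow, intervalIntegral.integral_const_mul,
      integral_pow]
    have : ∀ s, sin s * (c * (r ^ k * sin s ^ k * ∫ t in (0 : ℝ)..π, sin t ^ k)) =
        c * r ^ k * (∫ t in (0 : ℝ)..π, sin t ^ k) * sin s ^ (k + 1) := fun s => by ring
    simp only [this, intervalIntegral.integral_const_mul]
    rw [mul_assoc, mul_comm (∫ t in (0 : ℝ)..π, sin t ^ k), h]
    simp
    ring

/-- Injectivity of the Abel-type transform `g ↦ (a ↦ ∫ t in 0..π, g (a * sin t))`. -/
theorem eq_zero_of_integral_comp_mul_sin_eq_zero {g : ℝ → ℝ} (hg : Continuous g)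
    (h : ∀ a ∈ Set.Icc (0 : ℝ) 1, ∫ t in (0 : ℝ)..π, g (a * sin t) = 0) :
    ∀ r ∈ Set.Icc (0 : ℝ) 1, g r = 0 := by
  have hmean : ∀ r ∈ Set.Icc (0 : ℝ) 1, ∫ z in (0 : ℝ)..1, g (r * z) = 0 := by
    intro r hr
    have hle : ∀ ε > 0, |∫ z in (0 : ℝ)..1, g (r * z)| ≤ ε * (π / 2 + 1) := by
      intro ε hε
      obtain ⟨p, hp⟩ := exists_polynomial_near_of_continuousOn 0 1 g hg.continuousOn ε hε
      have hsin : ∀ t ∈ Set.uIoc 0 π, sin t ∈ Set.Icc (0 : ℝ) 1 := by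
        intro t ht
        rw [Set.uIoc_of_le pi_pos.le] at ht
        exact ⟨sin_nonneg_of_nonneg_of_le_pi ht.1.le ht.2, sin_le_one t⟩
      have hinner : ∀ a ∈ Set.Icc (0 : ℝ) 1,
          |∫ t in (0 : ℝ)..π, p.eval (a * sin t)| ≤ ε * π := by
        intro a ha
        have hsub : ∫ t in (0 : ℝ)..π, p.eval (a * sin t) =
            ∫ t in (0 : ℝ)..π, (p.eval (a * sin t) - g (a * sin t)) := by
          rw [intervalIntegral.integral_sub, h a ha, sub_zero]
          · exact (p.continuous.comp (by fun_prop)).intervalIntegrable _ _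
          · exact (hg.comp (by fun_prop)).intervalIntegrable _ _
        rw [hsub]
        have := intervalIntegral.norm_integral_le_of_norm_le_const (a := 0) (b := π)
          (f := fun t => p.eval (a * sin t) - g (a * sin t)) (C := ε) fun t ht =>
            (hp _ (unitInterval.mul_mem ha (hsin t ht))).le
        simpa [abs_of_pos pi_pos] using this
      have houter : |2 * π * ∫ z in (0 : ℝ)..1, p.eval (r * z)| ≤ ε * π * π := by
        rw [← p.integral_sin_mul_integral_eval_sin_mul_sin]
        have := intervalIntegral.norm_integral_le_of_norm_le_const (a := 0) (b := π)
          (f := fun s => sin s * ∫ t in (0 : ℝ)..π, p.eval (r * sin s * sin t))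
          (C := ε * π) fun s hs => by
            rw [norm_mul, Real.norm_eq_abs, Real.norm_eq_abs]
            have h1 := hinner _ (unitInterval.mul_mem hr (hsin s hs))
            exact (mul_le_of_le_one_left (abs_nonneg _) (abs_sin_le_one s)).trans h1
        simpa [abs_of_pos pi_pos] using this
      have hdiff : |∫ z in (0 : ℝ)..1, (p.eval (r * z) - g (r * z))| ≤ ε := by
        have := intervalIntegral.norm_integral_le_of_norm_le_const (a := 0) (b := 1)
          (f := fun z => p.eval (r * z) - g (r * z)) (C := ε) fun z hz => by
            rw [Set.uIoc_of_le zero_le_one] at hz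
            exact (hp _ (unitInterval.mul_mem hr ⟨hz.1.le, hz.2⟩)).le
        simpa using this
      have hip : IntervalIntegrable (fun z => p.eval (r * z)) MeasureTheory.volume 0 1 :=
        (p.continuous.comp (by fun_prop)).intervalIntegrable _ _
      have hig : IntervalIntegrable (fun z => g (r * z)) MeasureTheory.volume 0 1 :=
        (hg.comp (by fun_prop)).intervalIntegrable _ _
      rw [intervalIntegral.integral_sub hip hig] at hdiff
      have hp2 : |∫ z in (0 : ℝ)..1, p.eval (r * z)| ≤ ε * (π / 2) := by
        rw [abs_mul, abs_of_pos two_pi_pos] at houter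
        refine le_of_mul_le_mul_left ?_ two_pi_pos
        linarith
      rw [abs_le] at *
      constructor <;> linarith [hdiff.1, hdiff.2, hp2.1, hp2.2]
    have hlim : Filter.Tendsto (fun ε : ℝ => ε * (π / 2 + 1)) (nhdsWithin 0 (Set.Ioi 0))
        (nhds 0) := by
      have : Continuous fun ε : ℝ => ε * (π / 2 + 1) := by fun_prop
      simpa using (this.tendsto 0).mono_left nhdsWithin_le_nhds
    exact abs_nonpos_iff.1
      (ge_of_tendsto hlim (Filter.eventually_of_mem self_mem_nhdsWithin hle))
  have hprim : ∀ r ∈ Set.Icc (0 : ℝ) 1, ∫ z in (0 : ℝ)..r, g z = 0 := by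
    intro r hr
    have := intervalIntegral.mul_integral_comp_mul_left (a := 0) (b := 1) (f := g) r
    simpa [hmean r hr] using this.symm
  intro r hr
  have hd : HasDerivWithinAt (fun r => ∫ z in (0 : ℝ)..r, g z) (g r) (Set.Icc 0 1) r :=
    (hg.integral_hasStrictDerivAt 0 r).hasDerivAt.hasDerivWithinAt
  have h0 : HasDerivWithinAt (fun r => ∫ z in (0 : ℝ)..r, g z) 0 (Set.Icc 0 1) r :=
    (hasDerivWithinAt_const r _ (0 : ℝ)).congr hprim (hprim r hr)
  exact (uniqueDiffOn_Icc zero_lt_one r hr).eq_deriv _ hd h0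

theorem exists_cos_sin_eq_of_sq_add_sq_eq_sq {x y c : ℝ} (h : x ^ 2 + y ^ 2 = c ^ 2)
    (hc : 0 ≤ c) : ∃ δ, x = c * cos δ ∧ y = c * sin δ := by
  refine ⟨Complex.arg ⟨x, y⟩, ?_⟩
  have hn : ‖(⟨x, y⟩ : ℂ)‖ = c := by
    rw [Complex.norm_eq_sqrt_sq_add_sq, h, sqrt_sq hc]
  constructor
  · rw [← hn, Complex.norm_mul_cos_arg]
  · rw [← hn, Complex.norm_mul_sin_arg]

section LatitudeIntegral

variable {E : Type*} [NormedAddCommGroup E] [InnerProductSpace ℝ E]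

/-- The integral of `f` over the latitude circle at height `z` with respect to the axis `p`,
in the span of `p`, `e₁` and `e₂`. -/
noncomputable def latitudeIntegral (f : E → ℝ) (p e₁ e₂ : E) (z : ℝ) : ℝ :=
  ∫ φ in (0 : ℝ)..(2 * π), f (z • p + √(1 - z ^ 2) • (cos φ • e₁ + sin φ • e₂))

theorem continuous_latitudeIntegral {f : E → ℝ} (hf : Continuous f) (p e₁ e₂ : E) :
    Continuous (latitudeIntegral f p e₁ e₂) := by
  refine intervalIntegral.continuous_parametric_intervalIntegral_of_continuous' ?_ _ _
  exact hf.comp (by fun_prop)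

/-- Averaging over all rotations about the axis `p` turns a point of a great circle whose plane
has inclination `a` into a latitude circle. -/
theorem integral_rotation_eq_latitudeIntegral (f : E → ℝ) (p e₁ e₂ : E) {a : ℝ}
    (ha : a ∈ Set.Icc (0 : ℝ) 1) (t : ℝ) :
    (∫ φ in (0 : ℝ)..(2 * π), f (cos t • (cos φ • e₁ + sin φ • e₂) +
      sin t • (a • p + √(1 - a ^ 2) • (-sin φ • e₁ + cos φ • e₂)))) =
      latitudeIntegral f p e₁ e₂ (a * sin t) := by
  have ha2 : 0 ≤ 1 - a ^ 2 := by nlinarith [ha.1, ha.2]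
  have hz2 : 0 ≤ 1 - (a * sin t) ^ 2 := by
    nlinarith [sin_sq_add_cos_sq t, mul_nonneg ha2 (sq_nonneg (sin t)), sq_nonneg (cos t)]
  obtain ⟨δ, h1, h2⟩ := exists_cos_sin_eq_of_sq_add_sq_eq_sq
    (x := cos t) (y := sin t * √(1 - a ^ 2)) (c := √(1 - (a * sin t) ^ 2))
    (by rw [mul_pow, sq_sqrt ha2, sq_sqrt hz2]; nlinarith [sin_sq_add_cos_sq t]) (sqrt_nonneg _)
  set F : ℝ → ℝ := fun φ =>
    f ((a * sin t) • p + √(1 - (a * sin t) ^ 2) • (cos φ • e₁ + sin φ • e₂)) with hF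
  have hper : Function.Periodic F (2 * π) := fun φ => by simp [hF]
  have hrot : ∀ φ, f (cos t • (cos φ • e₁ + sin φ • e₂) +
      sin t • (a • p + √(1 - a ^ 2) • (-sin φ • e₁ + cos φ • e₂))) = F (φ + δ) := by
    intro φ
    simp only [hF]
    congr 1
    rw [smul_add (sin t), smul_smul (sin t) (√_), h2, h1, cos_add, sin_add]
    module
  simp only [hrot]
  rw [intervalIntegral.integral_comp_add_right, zero_add, add_comm,
    hper.intervalIntegral_add_eq δ 0, zero_add]
  rfl

end LatitudeIntegral

/-- The Funk transform is injective on even continuous functions on `S^n` (`n ≥ 2`):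
if `f` is even on the unit sphere and all its great-circle integrals vanish, then `f`
vanishes on the unit sphere. -/
theorem funk_transform_injective_on_even (n : ℕ) (hn : 2 ≤ n)
    (f : EuclideanSpace ℝ (Fin (n + 1)) → ℝ) (hf : Continuous f)
    (heven : ∀ x : EuclideanSpace ℝ (Fin (n + 1)), ‖x‖ = 1 → f (-x) = f x)
    (hfunk : ∀ u v : EuclideanSpace ℝ (Fin (n + 1)),
      ‖u‖ = 1 → ‖v‖ = 1 → ⟪u, v⟫ = 0 →
      (∫ t in (0 : ℝ)..(2 * π), f ((Real.cos t) • u + (Real.sin t) • v)) = 0) :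
    ∀ x : EuclideanSpace ℝ (Fin (n + 1)), ‖x‖ = 1 → f x = 0 := by
  intro p hp
  obtain ⟨e₁, e₂, h1, h2, h12, hp1, hp2⟩ :
      ∃ e₁ e₂ : EuclideanSpace ℝ (Fin (n + 1)),
        ‖e₁‖ = 1 ∧ ‖e₂‖ = 1 ∧ ⟪e₁, e₂⟫ = 0 ∧ ⟪p, e₁⟫ = 0 ∧ ⟪p, e₂⟫ = 0 := by
    obtain ⟨b, hb⟩ := Orthonormal.exists_orthonormalBasis_extension_of_card_eq (𝕜 := ℝ)
      (E := EuclideanSpace ℝ (Fin (n + 1))) (ι := Fin (n + 1)) (by simp)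
      (v := fun _ => p) (s := {0})
      ⟨fun _ => hp, fun i j hij => (hij (Subsingleton.elim i j)).elim⟩
    have hb0 : b 0 = p := hb 0 rfl
    rw [← hb0]
    refine ⟨b ⟨1, by omega⟩, b ⟨2, by omega⟩, b.orthonormal.1 _, b.orthonormal.1 _,
      b.orthonormal.2 ?_, b.orthonormal.2 ?_, b.orthonormal.2 ?_⟩ <;>
    simp [Fin.ext_iff]
  have hhalf : ∀ u v : EuclideanSpace ℝ (Fin (n + 1)), ‖u‖ = 1 → ‖v‖ = 1 → ⟪u, v⟫ = 0 →
      ∫ t in (0 : ℝ)..π, f (cos t • u + sin t • v) = 0 := by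
    intro u v hu hv huv
    have hi (a b : ℝ) : IntervalIntegrable (fun t => f (cos t • u + sin t • v))
        MeasureTheory.volume a b := (hf.comp (by fun_prop)).intervalIntegrable _ _
    have hnorm (t : ℝ) : ‖cos t • u + sin t • v‖ = 1 := by
      have hsq : ‖cos t • u + sin t • v‖ ^ 2 = 1 := by
        rw [norm_add_sq_real]
        simp [inner_smul_left, inner_smul_right, huv, norm_smul, hu, hv]
      exact (pow_eq_one_iff_of_nonneg (norm_nonneg _) two_ne_zero).1 hsq
    have hshift := intervalIntegral.integral_comp_add_right (a := 0) (b := π)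
      (fun t => f (cos t • u + sin t • v)) π
    have hanti (t : ℝ) :
        f (cos (t + π) • u + sin (t + π) • v) = f (cos t • u + sin t • v) := by
      rw [← heven _ (hnorm t), cos_add_pi, sin_add_pi]
      congr 1
      module
    simp only [hanti] at hshift
    have hadd := intervalIntegral.integral_add_adjacent_intervals (hi 0 π) (hi π (2 * π))
    rw [hfunk u v hu hv huv] at hadd
    rw [zero_add, ← two_mul] at hshift
    linarith
  have habel : ∀ a ∈ Set.Icc (0 : ℝ) 1,
      ∫ t in (0 : ℝ)..π, latitudeIntegral f p e₁ e₂ (a * sin t) = 0 := by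
    intro a ha
    have ha2 : 0 ≤ 1 - a ^ 2 := by nlinarith [ha.1, ha.2]
    simp only [← integral_rotation_eq_latitudeIntegral f p e₁ e₂ ha]
    rw [MeasureTheory.intervalIntegral_intervalIntegral_swap]
    · refine (intervalIntegral.integral_congr fun φ _ => ?_).trans intervalIntegral.integral_zero
      have h21 : ⟪e₂, e₁⟫ = 0 := by rw [real_inner_comm, h12]
      have hq1 : ⟪e₁, p⟫ = 0 := by rw [real_inner_comm, hp1]
      have hq2 : ⟪e₂, p⟫ = 0 := by rw [real_inner_comm, hp2]
      have hu : ‖cos φ • e₁ + sin φ • e₂‖ ^ 2 = 1 := by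
        rw [← real_inner_self_eq_norm_sq]
        simp only [inner_add_left, inner_add_right, inner_smul_left, inner_smul_right, h12, h21,
          real_inner_self_eq_norm_sq, h1, h2, conj_trivial]
        linarith [sin_sq_add_cos_sq φ]
      have hv : ‖a • p + √(1 - a ^ 2) • (-sin φ • e₁ + cos φ • e₂)‖ ^ 2 = 1 := by
        rw [← real_inner_self_eq_norm_sq]
        simp only [inner_add_left, inner_add_right, inner_smul_left, inner_smul_right, h12, h21,
          real_inner_self_eq_norm_sq, h1, h2, hp, hp1, hp2, hq1, hq2, conj_trivial]
        linear_combination (1 - a ^ 2) * sin_sq_add_cos_sq φ +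
          (sin φ ^ 2 + cos φ ^ 2) * sq_sqrt ha2
      refine hhalf _ _ ((pow_eq_one_iff_of_nonneg (norm_nonneg _) two_ne_zero).1 hu)
        ((pow_eq_one_iff_of_nonneg (norm_nonneg _) two_ne_zero).1 hv) ?_
      simp only [inner_add_left, inner_add_right, inner_smul_left, inner_smul_right, h12, h21,
        real_inner_self_eq_norm_sq, h1, h2, hq1, hq2, conj_trivial]
      ring
    · refine (ContinuousOn.integrableOn_compact (isCompact_uIcc.prod isCompact_uIcc) ?_).mono_set
        (Set.prod_mono Set.uIoc_subset_uIcc Set.uIoc_subset_uIcc)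
      exact (hf.comp (by fun_prop)).continuousOn
  have h := eq_zero_of_integral_comp_mul_sin_eq_zero (continuous_latitudeIntegral hf p e₁ e₂)
    habel 1 (by simp)
  simpa [latitudeIntegral, pi_ne_zero] using h
end
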